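/- Let f, r : ℝ → ℝ be of class C² with r and f' uniformly Lipschitz. Then for every ρ > 0 and T > 0 there exists a positive constant L such that: whenever y₁ and y₂ are classical solutions of y_t + (f(y))_x = y_xx + r(y) on [0,1] × (0,T] with homogeneous Dirichlet boundary conditions, with initial data in H¹₀(0,1) satisfying max{ ‖y₁(·,0)‖, ‖y₂(·,0)‖ } < ρ, one has ‖y₁(·,t) − y₂(·,t)‖² ≤ L ‖y₁(·,0) − y₂(·,0)‖² for all 0 ≤ t ≤ T, where ‖·‖ denotes the L²(0,1) norm. -/

import Mathlib

open Set MeasureTheory intervalIntegral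

/-- `y` is a classical solution of `y_t + (f(y))_x = y_xx + r(y)` on `[0,1] × (0,T]`
with homogeneous Dirichlet boundary conditions. -/
def IsClassicalSolutionOnIoc (f r : ℝ → ℝ) (T : ℝ) (y : ℝ → ℝ → ℝ) : Prop :=
  ContinuousOn (fun pt : ℝ × ℝ => y pt.1 pt.2) (Icc 0 1 ×ˢ Icc 0 T) ∧
  (∀ t ∈ Ioc (0:ℝ) T, ContDiffOn ℝ 2 (fun x => y x t) (Icc 0 1)) ∧
  (∀ t ∈ Icc (0:ℝ) T, y 0 t = 0 ∧ y 1 t = 0) ∧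
  (∀ x ∈ Ioo (0:ℝ) 1, ∀ t ∈ Ioc (0:ℝ) T,
    HasDerivWithinAt (fun s => y x s)
      (deriv (deriv (fun x' => y x' t)) x - deriv (fun x' => f (y x' t)) x + r (y x t))
      (Iic T) t)

/-- `u` belongs to `H¹₀(0,1)`, with (weak) derivative `u'` in `L²`: `u` is absolutely
continuous with `u(x) = ∫₀ˣ u'`, vanishes at both endpoints, and `u' ∈ L²(0,1)`. -/
def MemH10 (u u' : ℝ → ℝ) : Prop :=
  (∀ x ∈ Icc (0:ℝ) 1, u x = ∫ s in (0:ℝ)..x, u' s) ∧ u 1 = 0 ∧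
  MeasureTheory.IntegrableOn (fun x => (u' x) ^ 2) (Icc 0 1)

open Filter Topology

/-- The second-derivative necessary condition at a local maximum. -/
lemma IsLocalMax.second_deriv_nonpos {u p : ℝ → ℝ} {q x : ℝ} (hmax : IsLocalMax u x)
    (hu : ∀ᶠ z in 𝓝 x, HasDerivAt u (p z) z) (hp : HasDerivAt p q x) : q ≤ 0 := by
  by_contra! hq
  have hd : deriv u =ᶠ[𝓝 x] p := hu.mono fun z hz => hz.deriv
  have hdd : deriv (deriv u) x = q := by rw [hd.deriv_eq, hp.deriv]
  have hmin : IsLocalMin u x :=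
    isLocalMin_of_deriv_deriv_pos (by rwa [hdd]) hmax.deriv_eq_zero
      hu.self_of_nhds.continuousAt
  have hconst : u =ᶠ[𝓝 x] fun _ => u x := by
    filter_upwards [hmax, hmin] with z h1 h2 using le_antisymm h1 h2
  have h0 : deriv (deriv u) x = 0 := by
    rw [hconst.deriv.deriv_eq]; simp
  linarith

/-- A pointwise parabolic maximum principle: only differentiability from the left in time at the
spatial local maxima is used. -/
lemma le_mul_sub_of_deriv_lt_at_localMax {u : ℝ → ℝ → ℝ} {a T C : ℝ} (haT : a ≤ T) (hC : 0 ≤ C)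
    (hcont : ContinuousOn (fun z : ℝ × ℝ => u z.1 z.2) (Icc 0 1 ×ˢ Icc a T))
    (hbd : ∀ t ∈ Icc a T, u 0 t ≤ 0 ∧ u 1 t ≤ 0) (hinit : ∀ x ∈ Icc (0:ℝ) 1, u x a ≤ 0)
    (hder : ∀ x ∈ Ioo (0:ℝ) 1, ∀ t ∈ Ioc a T, IsLocalMax (fun z => u z t) x →
      ∃ d < C, HasDerivWithinAt (fun s => u x s) d (Iic t) t) :
    ∀ x ∈ Icc (0:ℝ) 1, ∀ t ∈ Icc a T, u x t ≤ C * (t - a) := by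
  obtain ⟨⟨x₀, t₀⟩, ⟨hx₀, ht₀⟩, hm⟩ :=
    (isCompact_Icc.prod isCompact_Icc).exists_isMaxOn
      (f := fun z : ℝ × ℝ => u z.1 z.2 - C * (z.2 - a))
      (s := Icc (0:ℝ) 1 ×ˢ Icc a T)
      ⟨(0, a), ⟨⟨le_rfl, zero_le_one⟩, ⟨le_rfl, haT⟩⟩⟩
      (hcont.sub (by fun_prop))
  simp only at hx₀ ht₀
  have hm' : ∀ x ∈ Icc (0:ℝ) 1, ∀ t ∈ Icc a T,
      u x t - C * (t - a) ≤ u x₀ t₀ - C * (t₀ - a) :=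
    fun x hx t ht => hm (show (x, t) ∈ _ from ⟨hx, ht⟩)
  suffices h : u x₀ t₀ - C * (t₀ - a) ≤ 0 by
    intro x hx t ht
    linarith [hm' x hx t ht]
  by_contra! hpos
  have hnn : 0 ≤ C * (t₀ - a) := mul_nonneg hC (by linarith [ht₀.1])
  have hx0 : x₀ ≠ 0 := by
    rintro rfl; linarith [(hbd t₀ ht₀).1]
  have hx1 : x₀ ≠ 1 := by
    rintro rfl; linarith [(hbd t₀ ht₀).2]
  have hta : t₀ ≠ a := by
    rintro rfl; linarith [hinit x₀ hx₀]
  have hxI : x₀ ∈ Ioo (0:ℝ) 1 := ⟨lt_of_le_of_ne hx₀.1 hx0.symm, lt_of_le_of_ne hx₀.2 hx1⟩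
  have htI : t₀ ∈ Ioc a T := ⟨lt_of_le_of_ne ht₀.1 hta.symm, ht₀.2⟩
  have hloc : IsLocalMax (fun z => u z t₀) x₀ := by
    filter_upwards [Icc_mem_nhds hxI.1 hxI.2] with z hz
    linarith [hm' z hz t₀ ht₀]
  obtain ⟨d, hdC, hd⟩ := hder x₀ hxI t₀ htI hloc
  have hlim := (hasDerivWithinAt_iff_tendsto_slope' (s := Iio t₀) (by simp)).1
    (hd.mono Iio_subset_Iic_self)
  have : C ≤ d := by
    refine ge_of_tendsto hlim ?_
    filter_upwards [Ioo_mem_nhdsLT htI.1] with s hs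
    have := hm' x₀ hx₀ s ⟨hs.1.le, hs.2.le.trans ht₀.2⟩
    rw [slope_def_field, le_div_iff_of_neg (by linarith [hs.2])]
    linarith
  linarith

/-- A function with its first two derivatives, continuous up to the boundary of `[0,1]`, and
vanishing at the endpoints. -/
structure IsC2Profile (u p q : ℝ → ℝ) : Prop where
  contU : ContinuousOn u (Icc 0 1)
  contP : ContinuousOn p (Icc 0 1)
  contQ : ContinuousOn q (Icc 0 1)
  derivU : ∀ x ∈ Ioo (0:ℝ) 1, HasDerivAt u (p x) x
  derivP : ∀ x ∈ Ioo (0:ℝ) 1, HasDerivAt p (q x) x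
  left : u 0 = 0
  right : u 1 = 0

lemma IsC2Profile.sub {u p q v p' q' : ℝ → ℝ} (h : IsC2Profile u p q) (h' : IsC2Profile v p' q') :
    IsC2Profile (fun x => u x - v x) (fun x => p x - p' x) (fun x => q x - q' x) where
  contU := h.contU.sub h'.contU
  contP := h.contP.sub h'.contP
  contQ := h.contQ.sub h'.contQ
  derivU x hx := (h.derivU x hx).sub (h'.derivU x hx)
  derivP x hx := (h.derivP x hx).sub (h'.derivP x hx)
  left := by simp [h.left, h'.left]
  right := by simp [h.right, h'.right]

lemma IsC2Profile.const_mul {u p q : ℝ → ℝ} (h : IsC2Profile u p q) (c : ℝ) :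
    IsC2Profile (fun x => c * u x) (fun x => c * p x) (fun x => c * q x) where
  contU := continuousOn_const.mul h.contU
  contP := continuousOn_const.mul h.contP
  contQ := continuousOn_const.mul h.contQ
  derivU x hx := (h.derivU x hx).const_mul c
  derivP x hx := (h.derivP x hx).const_mul c
  left := by simp [h.left]
  right := by simp [h.right]

lemma IsC2Profile.isLocalMax {u p q : ℝ → ℝ} (h : IsC2Profile u p q) {x : ℝ}
    (hx : x ∈ Ioo (0:ℝ) 1) (hmax : IsLocalMax u x) : p x = 0 ∧ q x ≤ 0 :=
  ⟨hmax.hasDerivAt_eq_zero (h.derivU x hx),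
    hmax.second_deriv_nonpos (by
      filter_upwards [isOpen_Ioo.mem_nhds hx] with z hz using h.derivU z hz) (h.derivP x hx)⟩

lemma exists_isC2Profile {u : ℝ → ℝ} (hu : ContDiffOn ℝ 2 u (Icc 0 1)) (h0 : u 0 = 0)
    (h1 : u 1 = 0) :
    ∃ p q, IsC2Profile u p q ∧ ∀ x ∈ Ioo (0:ℝ) 1, deriv (deriv u) x = q x := by
  have huniq : UniqueDiffOn ℝ (Icc (0:ℝ) 1) := uniqueDiffOn_Icc zero_lt_one
  have hp : ContDiffOn ℝ 1 (derivWithin u (Icc 0 1)) (Icc 0 1) :=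
    hu.derivWithin huniq (by norm_num)
  have hq : ContDiffOn ℝ 0 (derivWithin (derivWithin u (Icc 0 1)) (Icc 0 1)) (Icc 0 1) :=
    hp.derivWithin huniq (by norm_num)
  have hdu : ∀ x ∈ Ioo (0:ℝ) 1, HasDerivAt u (derivWithin u (Icc 0 1) x) x := fun x hx =>
    ((hu.differentiableOn (by norm_num) x (Ioo_subset_Icc_self hx)).hasDerivWithinAt).hasDerivAt
      (Icc_mem_nhds hx.1 hx.2)
  have hdp : ∀ x ∈ Ioo (0:ℝ) 1, HasDerivAt (derivWithin u (Icc 0 1))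
      (derivWithin (derivWithin u (Icc 0 1)) (Icc 0 1) x) x := fun x hx =>
    ((hp.differentiableOn (by norm_num) x (Ioo_subset_Icc_self hx)).hasDerivWithinAt).hasDerivAt
      (Icc_mem_nhds hx.1 hx.2)
  refine ⟨_, _, ⟨hu.continuousOn, hp.continuousOn, hq.continuousOn, hdu, hdp, h0, h1⟩,
    fun x hx => ?_⟩
  have : deriv u =ᶠ[𝓝 x] derivWithin u (Icc 0 1) := by
    filter_upwards [isOpen_Ioo.mem_nhds hx] with z hz using (hdu z hz).deriv
  rw [this.deriv_eq, (hdp x hx).deriv]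

/-- At each positive time a classical solution has a profile in terms of which the equation
takes its nondivergence form. -/
lemma IsClassicalSolutionOnIoc.exists_profile {f r : ℝ → ℝ} {T : ℝ} {y : ℝ → ℝ → ℝ}
    (hf : ContDiff ℝ 2 f) (h : IsClassicalSolutionOnIoc f r T y) {t : ℝ} (ht : t ∈ Ioc 0 T) :
    ∃ p q, IsC2Profile (fun x => y x t) p q ∧ ∀ x ∈ Ioo (0:ℝ) 1,
      HasDerivWithinAt (fun s => y x s) (q x - deriv f (y x t) * p x + r (y x t)) (Iic T) t := by
  obtain ⟨-, hC2, hbd, heq⟩ := h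
  have htI := Ioc_subset_Icc_self ht
  obtain ⟨p, q, hpq, hdd⟩ := exists_isC2Profile (hC2 t ht) (hbd t htI).1 (hbd t htI).2
  refine ⟨p, q, hpq, fun x hx => ?_⟩
  have hfy : deriv (fun x' => f (y x' t)) x = deriv f (y x t) * p x :=
    (((hf.differentiable (by norm_num)) (y x t)).hasDerivAt.comp x (hpq.derivU x hx)).deriv
  have := heq x hx t ht
  rwa [hdd x hx, hfy] at this

/-- Classical solutions are Lipschitz forward in time from each positive time, uniformly in
space. -/
lemma IsClassicalSolutionOnIoc.exists_forward_lipschitz {f r : ℝ → ℝ} {T : ℝ} {y : ℝ → ℝ → ℝ}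
    (hf : ContDiff ℝ 2 f) (hr : Continuous r) (h : IsClassicalSolutionOnIoc f r T y) {a : ℝ}
    (ha : a ∈ Ioc 0 T) :
    ∃ C, ∀ x ∈ Icc (0:ℝ) 1, ∀ t ∈ Icc a T, |y x t - y x a| ≤ C * (t - a) := by
  obtain ⟨p, q, hpq, -⟩ := h.exists_profile hf ha
  have hsub : Icc (0:ℝ) 1 ×ˢ Icc a T ⊆ Icc 0 1 ×ˢ Icc 0 T :=
    prod_mono_right (Icc_subset_Icc_left ha.1.le)
  obtain ⟨P, hP⟩ := isCompact_Icc.exists_bound_of_continuousOn hpq.contP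
  obtain ⟨Q, hQ⟩ := isCompact_Icc.exists_bound_of_continuousOn hpq.contQ
  have hf' : Continuous (deriv f) := hf.continuous_deriv (by norm_num)
  obtain ⟨F, hF⟩ := (isCompact_Icc.prod isCompact_Icc).exists_bound_of_continuousOn
    (hf'.comp_continuousOn h.1)
  obtain ⟨R, hR⟩ := (isCompact_Icc.prod isCompact_Icc).exists_bound_of_continuousOn
    (hr.comp_continuousOn h.1)
  simp only [Real.norm_eq_abs, Function.comp_apply] at hP hQ hF hR
  have h0 : (0:ℝ) ∈ Icc (0:ℝ) 1 := ⟨le_rfl, zero_le_one⟩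
  have hP0 := (abs_nonneg _).trans (hP 0 h0)
  have hQ0 := (abs_nonneg _).trans (hQ 0 h0)
  have hF0 := (abs_nonneg _).trans (hF (0, a) ⟨h0, Ioc_subset_Icc_self ha⟩)
  have hR0 := (abs_nonneg _).trans (hR (0, a) ⟨h0, Ioc_subset_Icc_self ha⟩)
  have key : ∀ σ : ℝ, |σ| = 1 → ∀ x ∈ Icc (0:ℝ) 1, ∀ t ∈ Icc a T,
      σ * (y x t - y x a) ≤ (Q + F * P + R + 1) * (t - a) := by
    intro σ hσ
    refine le_mul_sub_of_deriv_lt_at_localMax (u := fun x t => σ * (y x t - y x a)) ha.2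
      (by positivity) ?_ ?_ ?_ ?_
    · refine continuousOn_const.mul ((h.1.mono hsub).sub ?_)
      exact hpq.contU.comp continuousOn_fst fun z hz => hz.1
    · intro t ht
      have h1 := h.2.2.1 t ⟨ha.1.le.trans ht.1, ht.2⟩
      have h2 := h.2.2.1 a (Ioc_subset_Icc_self ha)
      simp [h1, h2]
    · intro x _; simp
    · intro x hx t ht hmax
      have htI : t ∈ Ioc 0 T := ⟨ha.1.trans ht.1, ht.2⟩
      have hxI := Ioo_subset_Icc_self hx
      obtain ⟨p', q', hpq', heq⟩ := h.exists_profile hf htI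
      obtain ⟨e1, e2⟩ := ((hpq'.sub hpq).const_mul σ).isLocalMax hx hmax
      have hσ0 : σ ≠ 0 := by rintro rfl; simp at hσ
      have e3 : p' x = p x := by
        have := (mul_eq_zero.1 e1).resolve_left hσ0
        linarith
      refine ⟨σ * (q' x - deriv f (y x t) * p' x + r (y x t)), ?_,
        (((heq x hx).mono (Iic_subset_Iic.2 ht.2)).sub_const _).const_mul σ⟩
      rw [e3]
      have b1 : σ * q x ≤ Q := (le_abs_self _).trans (by rw [abs_mul, hσ, one_mul]; exact hQ x hxI)
      have b2 : σ * r (y x t) ≤ R := (le_abs_self _).trans (by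
        rw [abs_mul, hσ, one_mul]; exact hR (x, t) ⟨hxI, Ioc_subset_Icc_self htI⟩)
      have b3 : -(σ * (deriv f (y x t) * p x)) ≤ F * P := (neg_le_abs _).trans (by
        rw [abs_mul, hσ, one_mul, abs_mul]
        exact mul_le_mul (hF (x, t) ⟨hxI, Ioc_subset_Icc_self htI⟩) (hP x hxI) (abs_nonneg _) hF0)
      linarith
  refine ⟨Q + F * P + R + 1, fun x hx t ht => abs_le.2 ⟨?_, ?_⟩⟩
  · linarith [key (-1) (by simp) x hx t ht]
  · linarith [key 1 (by simp) x hx t ht]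

/-- One-sided differentiation under the integral sign for the squared `L²` norm. -/
lemma hasDerivWithinAt_integral_sq {u : ℝ → ℝ → ℝ} {a T C : ℝ} {g : ℝ → ℝ} (haT : a < T)
    (hcont : ∀ s ∈ Icc a T, ContinuousOn (fun x => u x s) (Icc 0 1))
    (hlip : ∀ x ∈ Icc (0:ℝ) 1, ∀ t ∈ Icc a T, |u x t - u x a| ≤ C * (t - a))
    (hder : ∀ x ∈ Ioo (0:ℝ) 1, HasDerivWithinAt (fun s => u x s) (g x) (Ioi a) a) :
    HasDerivWithinAt (fun s => ∫ x in (0:ℝ)..1, (u x s) ^ 2)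
      (∫ x in (0:ℝ)..1, 2 * u x a * g x) (Ici a) a := by
  have haI : a ∈ Icc a T := ⟨le_rfl, haT.le⟩
  have hsq : ∀ s ∈ Icc a T, ContinuousOn (fun x => (u x s) ^ 2) (Icc 0 1) :=
    fun s hs => (hcont s hs).pow 2
  have hint : ∀ s ∈ Icc a T, IntervalIntegrable (fun x => (u x s) ^ 2) volume 0 1 :=
    fun s hs => (hsq s hs).intervalIntegrable_of_Icc zero_le_one
  obtain ⟨M, hM⟩ := isCompact_Icc.exists_bound_of_continuousOn (hcont a haI)
  simp only [Real.norm_eq_abs] at hM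
  have hC : 0 ≤ C := by
    have := (abs_nonneg _).trans (hlip 0 ⟨le_rfl, zero_le_one⟩ T ⟨haT.le, le_rfl⟩)
    exact nonneg_of_mul_nonneg_left this (sub_pos.2 haT)
  rw [← hasDerivWithinAt_Ioi_iff_Ici, hasDerivWithinAt_iff_tendsto_slope' (by simp)]
  have hev : ∀ᶠ s in 𝓝[>] a, s ∈ Ioo a T := Ioo_mem_nhdsGT haT
  have hmain : Tendsto (fun s => ∫ x in (0:ℝ)..1, slope (fun s => (u x s) ^ 2) a s) (𝓝[>] a)
      (𝓝 (∫ x in (0:ℝ)..1, 2 * u x a * g x)) := by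
    refine intervalIntegral.tendsto_integral_filter_of_dominated_convergence
      (fun _ => C * (2 * M + C * (T - a))) ?_ ?_ intervalIntegrable_const ?_
    · filter_upwards [hev] with s hs
      have hsI := Ioo_subset_Icc_self hs
      have : ContinuousOn (fun x => slope (fun s => (u x s) ^ 2) a s) (Icc 0 1) := by
        simp only [slope_def_field]
        exact ((hsq s hsI).sub (hsq a haI)).div_const _
      rw [uIoc_of_le zero_le_one]
      exact (this.mono Ioc_subset_Icc_self).aestronglyMeasurable measurableSet_Ioc
    · filter_upwards [hev] with s hs
      refine Eventually.of_forall fun x hx => ?_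
      rw [uIoc_of_le zero_le_one] at hx
      have hxI := Ioc_subset_Icc_self hx
      have hsa : 0 < s - a := sub_pos.2 hs.1
      have h1 := hlip x hxI s (Ioo_subset_Icc_self hs)
      have h2 := hM x hxI
      have h3 : |u x s + u x a| ≤ 2 * M + C * (T - a) := by
        have : u x s + u x a = (u x s - u x a) + 2 * u x a := by ring
        rw [this]
        refine (abs_add_le _ _).trans ?_
        rw [abs_mul, abs_two]
        have : C * (s - a) ≤ C * (T - a) := by gcongr; exact hs.2.le
        linarith
      rw [slope_def_field, Real.norm_eq_abs, abs_div, abs_of_pos hsa, div_le_iff₀ hsa]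
      calc |u x s ^ 2 - u x a ^ 2| = |u x s - u x a| * |u x s + u x a| := by
            rw [← abs_mul]; congr 1; ring
        _ ≤ (C * (s - a)) * (2 * M + C * (T - a)) :=
            mul_le_mul h1 h3 (abs_nonneg _) (by positivity)
        _ = _ := by ring
    · have h1 : ∀ᵐ x : ℝ, x ≠ 1 := by simp [ae_iff]
      filter_upwards [h1] with x hx1 hx
      rw [uIoc_of_le zero_le_one] at hx
      have := (hder x ⟨hx.1, lt_of_le_of_ne hx.2 hx1⟩).pow 2
      rw [hasDerivWithinAt_iff_tendsto_slope' (by simp)] at this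
      simpa [Pi.pow_def] using this
  refine hmain.congr' ?_
  filter_upwards [hev] with s hs
  simp only [slope_def_field]
  rw [intervalIntegral.integral_div,
    intervalIntegral.integral_sub (hint s (Ioo_subset_Icc_self hs)) (hint a haI)]

lemma IsC2Profile.integral_deriv_eq_zero {u p q φ φ' : ℝ → ℝ} (h : IsC2Profile u p q)
    (hφ : ∀ z, HasDerivAt φ (φ' z) z) (hφ' : Continuous φ') :
    ∫ x in (0:ℝ)..1, p x * φ' (u x) = 0 := by
  have hφc : Continuous φ := continuous_iff_continuousAt.2 fun z => (hφ z).continuousAt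
  rw [intervalIntegral.integral_eq_sub_of_hasDerivAt_of_le (f := fun x => φ (u x))
    (f' := fun x => p x * φ' (u x)) zero_le_one
    (hφc.comp_continuousOn h.contU)
    (fun x hx => by simpa [mul_comm, Function.comp_def] using (hφ (u x)).comp x (h.derivU x hx))
    ((h.contP.mul (hφ'.comp_continuousOn h.contU)).intervalIntegrable_of_Icc zero_le_one),
    h.left, h.right, sub_self]

lemma IsC2Profile.integral_flux_eq_zero {u p q f : ℝ → ℝ} (h : IsC2Profile u p q)
    (hf : Continuous f) : ∫ x in (0:ℝ)..1, p x * f (u x) = 0 :=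
  h.integral_deriv_eq_zero (φ := fun z => ∫ s in (0:ℝ)..z, f s)
    (fun z => hf.integral_hasStrictDerivAt 0 z |>.hasDerivAt) hf

lemma IsC2Profile.integral_by_parts {u p q G g : ℝ → ℝ} (h : IsC2Profile u p q)
    (hG : ContinuousOn G (Icc 0 1)) (hg : ContinuousOn g (Icc 0 1))
    (hGg : ∀ x ∈ Ioo (0:ℝ) 1, HasDerivAt G (g x) x) :
    ∫ x in (0:ℝ)..1, 2 * u x * (q x - g x) = ∫ x in (0:ℝ)..1, (2 * (p x * G x) - 2 * p x ^ 2) := by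
  have hu := h.contU
  have hp := h.contP
  have hq := h.contQ
  have key := intervalIntegral.integral_eq_sub_of_hasDerivAt_of_le
    (f := fun x => 2 * u x * (p x - G x))
    (f' := fun x => 2 * p x * (p x - G x) + 2 * u x * (q x - g x)) zero_le_one (by fun_prop)
    (fun x hx => ((h.derivU x hx).const_mul 2).mul ((h.derivP x hx).sub (hGg x hx)))
    (ContinuousOn.intervalIntegrable_of_Icc zero_le_one (by fun_prop))
  rw [h.left, h.right, intervalIntegral.integral_add
    (ContinuousOn.intervalIntegrable_of_Icc zero_le_one (by fun_prop))
    (ContinuousOn.intervalIntegrable_of_Icc zero_le_one (by fun_prop))] at key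
  have : ∫ x in (0:ℝ)..1, (2 * (p x * G x) - 2 * p x ^ 2)
      = - ∫ x in (0:ℝ)..1, 2 * p x * (p x - G x) := by
    rw [← intervalIntegral.integral_neg]
    congr 1 with x; ring
  rw [this]; linarith

lemma IsC2Profile.sq_le {u p q : ℝ → ℝ} (h : IsC2Profile u p q) {x : ℝ} (hx : x ∈ Icc (0:ℝ) 1) :
    u x ^ 2 ≤ (∫ x in (0:ℝ)..1, u x ^ 2) + ∫ x in (0:ℝ)..1, p x ^ 2 := by
  have hu := h.contU
  have hp := h.contP
  have hsub : Icc 0 x ⊆ Icc (0:ℝ) 1 := Icc_subset_Icc_right hx.2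
  have hi : ∀ F : ℝ → ℝ, ContinuousOn F (Icc 0 1) → IntervalIntegrable F volume 0 1 :=
    fun F hF => hF.intervalIntegrable_of_Icc zero_le_one
  have hix : ∀ F : ℝ → ℝ, ContinuousOn F (Icc 0 1) → IntervalIntegrable F volume 0 x :=
    fun F hF => (hF.mono hsub).intervalIntegrable_of_Icc hx.1
  have key := intervalIntegral.integral_eq_sub_of_hasDerivAt_of_le
    (f := fun x => u x ^ 2) (f' := fun x => 2 * u x * p x) hx.1 ((hu.pow 2).mono hsub)
    (fun z hz => by simpa using (h.derivU z ⟨hz.1, hz.2.trans_le hx.2⟩).fun_pow 2)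
    (hix _ (by fun_prop))
  rw [h.left] at key
  rw [← intervalIntegral.integral_add (hi _ (by fun_prop)) (hi _ (by fun_prop))]
  calc u x ^ 2 = ∫ z in (0:ℝ)..x, 2 * u z * p z := by rw [key]; ring
    _ ≤ ∫ z in (0:ℝ)..x, (u z ^ 2 + p z ^ 2) :=
        intervalIntegral.integral_mono_on hx.1 (hix _ (by fun_prop)) (hix _ (by fun_prop))
          fun z _ => two_mul_le_add_sq _ _
    _ ≤ ∫ z in (0:ℝ)..1, (u z ^ 2 + p z ^ 2) :=
        intervalIntegral.integral_mono_interval le_rfl hx.1 hx.2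
          (Eventually.of_forall fun z => by positivity) (hi _ (by fun_prop))

/-- The squared `L²(0,1)` norm of the time slices of `u`. -/
noncomputable def sliceEnergy (u : ℝ → ℝ → ℝ) (t : ℝ) : ℝ := ∫ x in (0:ℝ)..1, (u x t) ^ 2

lemma sliceEnergy_nonneg (u : ℝ → ℝ → ℝ) (t : ℝ) : 0 ≤ sliceEnergy u t :=
  intervalIntegral.integral_nonneg zero_le_one fun _ _ => sq_nonneg _

lemma continuousOn_sliceEnergy {u : ℝ → ℝ → ℝ} {T : ℝ}
    (hcont : ContinuousOn (fun z : ℝ × ℝ => u z.1 z.2) (Icc 0 1 ×ˢ Icc 0 T)) :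
    ContinuousOn (sliceEnergy u) (Icc 0 T) := by
  obtain ⟨M, hM⟩ := (isCompact_Icc.prod isCompact_Icc).exists_bound_of_continuousOn (hcont.pow 2)
  intro t ht
  refine intervalIntegral.continuousWithinAt_of_dominated_interval (bound := fun _ => M) ?_ ?_
    intervalIntegrable_const ?_
  · filter_upwards [self_mem_nhdsWithin] with s hs
    rw [uIoc_of_le zero_le_one]
    refine ContinuousOn.aestronglyMeasurable (ContinuousOn.pow ?_ 2) measurableSet_Ioc
    exact hcont.comp (by fun_prop : ContinuousOn (fun x => ((x, s) : ℝ × ℝ)) _)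
      fun x hx => ⟨Ioc_subset_Icc_self hx, hs⟩
  · filter_upwards [self_mem_nhdsWithin] with s hs
    refine Eventually.of_forall fun x hx => ?_
    rw [uIoc_of_le zero_le_one] at hx
    exact hM (x, s) ⟨Ioc_subset_Icc_self hx, hs⟩
  · refine Eventually.of_forall fun x hx => ?_
    rw [uIoc_of_le zero_le_one] at hx
    refine ContinuousWithinAt.pow ?_ 2
    exact (hcont.comp (by fun_prop : ContinuousOn (fun s => ((x, s) : ℝ × ℝ)) (Icc 0 T))
      fun s hs => ⟨Ioc_subset_Icc_self hx, hs⟩) t ht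

/-- Grönwall's inequality with right derivatives on the open interval. -/
lemma le_exp_mul_of_deriv_right_le {g : ℝ → ℝ} {T c : ℝ} (hg : ContinuousOn g (Icc 0 T))
    (hder : ∀ t ∈ Ioo 0 T, ∃ d ≤ c * g t, HasDerivWithinAt g d (Ici t) t) :
    ∀ t ∈ Icc 0 T, g t ≤ Real.exp (c * t) * g 0 := by
  have hcont : ContinuousOn (fun t => Real.exp (-c * t) * g t) (Icc 0 T) := by fun_prop
  have hpos : ∀ a t, 0 < a → a ≤ t → t ≤ T →
      Real.exp (-c * t) * g t ≤ Real.exp (-c * a) * g a := by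
    intro a t ha hat htT
    choose! d hd hd' using hder
    have hsub : Icc a t ⊆ Icc 0 T := Icc_subset_Icc ha.le htT
    refine image_le_of_deriv_right_le_deriv_boundary (a := a) (b := t)
      (f := fun t => Real.exp (-c * t) * g t)
      (f' := fun s => Real.exp (-c * s) * (-c) * g s + Real.exp (-c * s) * d s)
      (B := fun _ => Real.exp (-c * a) * g a) (B' := fun _ => 0)
      (hcont.mono hsub) ?_ le_rfl continuousOn_const
      (fun s _ => hasDerivWithinAt_const _ _ _) ?_ ⟨hat, le_rfl⟩
    · intro s hs
      have hsI : s ∈ Ioo 0 T := ⟨ha.trans_le hs.1, hs.2.trans_le htT⟩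
      have h1 : HasDerivAt (fun t => Real.exp (-c * t)) (Real.exp (-c * s) * (-c)) s := by
        simpa using ((hasDerivAt_id s).const_mul (-c)).exp
      exact h1.hasDerivWithinAt.mul (hd' s hsI)
    · intro s hs
      have hsI : s ∈ Ioo 0 T := ⟨ha.trans_le hs.1, hs.2.trans_le htT⟩
      have := mul_le_mul_of_nonneg_left (hd s hsI) (Real.exp_pos (-c * s)).le
      linarith
  intro t ht
  suffices h : Real.exp (-c * t) * g t ≤ g 0 by
    calc g t = Real.exp (c * t) * (Real.exp (-c * t) * g t) := by
          rw [← mul_assoc, ← Real.exp_add]; simp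
      _ ≤ _ := by gcongr
  rcases ht.1.eq_or_lt with rfl | ht0
  · simp
  have hlim : Tendsto (fun a => Real.exp (-c * a) * g a) (𝓝[Ioo 0 t] 0) (𝓝 (g 0)) := by
    have := (hcont 0 ⟨le_rfl, ht.1.trans ht.2⟩).mono
      (Ioo_subset_Icc_self.trans (Icc_subset_Icc_right ht.2) : Ioo 0 t ⊆ Icc 0 T)
    simpa [ContinuousWithinAt] using this
  have : (𝓝[Ioo 0 t] (0:ℝ)).NeBot := left_nhdsWithin_Ioo_neBot ht0
  refine ge_of_tendsto hlim ?_
  filter_upwards [self_mem_nhdsWithin] with a ha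
  exact hpos a t ha.1 ha.2.le ht.2

/-- Dissipation inequality for a single classical solution. -/
lemma IsClassicalSolutionOnIoc.exists_energy_deriv_le {f r : ℝ → ℝ} {T : ℝ} {y : ℝ → ℝ → ℝ}
    (hf : ContDiff ℝ 2 f) {K : NNReal} (hr : LipschitzWith K r)
    (h : IsClassicalSolutionOnIoc f r T y) {a : ℝ} (ha : a ∈ Ioo 0 T) :
    ∃ e D, HasDerivWithinAt (sliceEnergy y) e (Ici a) a ∧ 0 ≤ D ∧
      (∀ x ∈ Icc (0:ℝ) 1, y x a ^ 2 ≤ sliceEnergy y a + D) ∧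
      e ≤ -2 * D + (2 * K + 1) * sliceEnergy y a + r 0 ^ 2 := by
  have ha' := Ioo_subset_Ioc_self ha
  obtain ⟨p, q, hpq, heq⟩ := h.exists_profile hf ha'
  obtain ⟨C, hC⟩ := h.exists_forward_lipschitz hf hr.continuous ha'
  have hfc := hf.continuous
  have hrc := hr.continuous
  have hf' : Continuous (deriv f) := hf.continuous_deriv (by norm_num)
  have hfd : ∀ z, HasDerivAt f (deriv f z) z :=
    fun z => (hf.differentiable (by norm_num) z).hasDerivAt
  have hy := hpq.contU
  have hp := hpq.contP
  have hq := hpq.contQ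
  have hfy : ContinuousOn (fun x => f (y x a)) (Icc 0 1) := hf.continuous.comp_continuousOn hy
  have hf'y : ContinuousOn (fun x => deriv f (y x a)) (Icc 0 1) := hf'.comp_continuousOn hy
  have hry : ContinuousOn (fun x => r (y x a)) (Icc 0 1) := hr.continuous.comp_continuousOn hy
  have hi : ∀ F : ℝ → ℝ, ContinuousOn F (Icc 0 1) → IntervalIntegrable F volume 0 1 :=
    fun F hF => hF.intervalIntegrable_of_Icc zero_le_one
  refine ⟨_, ∫ x in (0:ℝ)..1, p x ^ 2, hasDerivWithinAt_integral_sq ha.2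
    (fun s hs => (h.2.1 s ⟨ha.1.trans_le hs.1, hs.2⟩).continuousOn) hC
    (fun x hx => ((heq x hx).hasDerivAt (Iic_mem_nhds ha.2)).hasDerivWithinAt),
    intervalIntegral.integral_nonneg zero_le_one fun _ _ => sq_nonneg _,
    fun x hx => hpq.sq_le hx, ?_⟩
  have hparts := hpq.integral_by_parts (G := fun x => f (y x a))
    (g := fun x => deriv f (y x a) * p x) hfy (hf'y.mul hp)
    (fun x hx => (hfd (y x a)).comp x (hpq.derivU x hx))
  rw [intervalIntegral.integral_sub (hi _ (by fun_prop)) (hi _ (by fun_prop)),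
    intervalIntegral.integral_const_mul, intervalIntegral.integral_const_mul,
    hpq.integral_flux_eq_zero hf.continuous] at hparts
  have hsplit : ∫ x in (0:ℝ)..1, 2 * y x a * (q x - deriv f (y x a) * p x + r (y x a)) =
      (∫ x in (0:ℝ)..1, 2 * y x a * (q x - deriv f (y x a) * p x)) +
        ∫ x in (0:ℝ)..1, 2 * y x a * r (y x a) := by
    rw [← intervalIntegral.integral_add (hi _ (by fun_prop)) (hi _ (by fun_prop))]
    congr 1 with x; ring
  have hreact : ∫ x in (0:ℝ)..1, 2 * y x a * r (y x a) ≤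
      ∫ x in (0:ℝ)..1, ((2 * K + 1) * y x a ^ 2 + r 0 ^ 2) := by
    refine intervalIntegral.integral_mono_on zero_le_one (hi _ (by fun_prop)) (hi _ (by fun_prop))
      fun x _ => ?_
    have h1 : |r (y x a) - r 0| ≤ K * |y x a| := by
      simpa [Real.dist_eq] using hr.dist_le_mul (y x a) 0
    have h2 : y x a * (r (y x a) - r 0) ≤ K * y x a ^ 2 := by
      calc y x a * (r (y x a) - r 0) ≤ |y x a| * |r (y x a) - r 0| := by
            rw [← abs_mul]; exact le_abs_self _
        _ ≤ |y x a| * (K * |y x a|) := by gcongr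
        _ = K * y x a ^ 2 := by rw [← sq_abs (y x a)]; ring
    nlinarith [sq_nonneg (y x a - r 0)]
  rw [intervalIntegral.integral_add (hi _ (by fun_prop)) (hi _ (by fun_prop)),
    intervalIntegral.integral_const_mul, intervalIntegral.integral_const] at hreact
  rw [hsplit, hparts, sliceEnergy]
  simp only [sub_zero, one_smul] at hreact
  linarith

lemma abs_sub_le_of_lipschitzWith_deriv {f : ℝ → ℝ} (hf : Differentiable ℝ f) {K : NNReal}
    (hK : LipschitzWith K (deriv f)) {m b c : ℝ} (hb : |b| ≤ m) (hc : |c| ≤ m) :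
    |f b - f c| ≤ (|deriv f 0| + K * m) * |b - c| := by
  refine (convex_Icc (-m) m).norm_image_sub_le_of_norm_deriv_le (fun x _ => hf x) (fun x hx => ?_)
    (abs_le.1 hc) (abs_le.1 hb)
  have h1 : |deriv f x - deriv f 0| ≤ K * |x| := by
    simpa [Real.dist_eq] using hK.dist_le_mul x 0
  have h2 : K * |x| ≤ K * m := by gcongr; exact abs_le.2 hx
  have h3 := abs_add_le (deriv f x - deriv f 0) (deriv f 0)
  rw [sub_add_cancel] at h3
  rw [Real.norm_eq_abs]; linarith

/-- Energy inequality for the difference of two classical solutions. -/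
lemma IsClassicalSolutionOnIoc.exists_energy_sub_deriv_le {f r : ℝ → ℝ} {T : ℝ}
    {y₁ y₂ : ℝ → ℝ → ℝ} (hf : ContDiff ℝ 2 f) {K K' : NNReal} (hr : LipschitzWith K r)
    (hf'K : LipschitzWith K' (deriv f)) (h₁ : IsClassicalSolutionOnIoc f r T y₁)
    (h₂ : IsClassicalSolutionOnIoc f r T y₂) {a m : ℝ} (ha : a ∈ Ioo 0 T)
    (hm₁ : ∀ x ∈ Icc (0:ℝ) 1, |y₁ x a| ≤ m) (hm₂ : ∀ x ∈ Icc (0:ℝ) 1, |y₂ x a| ≤ m) :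
    ∃ e, HasDerivWithinAt (sliceEnergy fun x t => y₁ x t - y₂ x t) e (Ici a) a ∧
      e ≤ (deriv f 0 ^ 2 + K' ^ 2 * m ^ 2 + 2 * K) *
        sliceEnergy (fun x t => y₁ x t - y₂ x t) a := by
  have ha' := Ioo_subset_Ioc_self ha
  obtain ⟨p₁, q₁, hpq₁, heq₁⟩ := h₁.exists_profile hf ha'
  obtain ⟨p₂, q₂, hpq₂, heq₂⟩ := h₂.exists_profile hf ha'
  obtain ⟨C₁, hC₁⟩ := h₁.exists_forward_lipschitz hf hr.continuous ha'
  obtain ⟨C₂, hC₂⟩ := h₂.exists_forward_lipschitz hf hr.continuous ha'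
  have hfc := hf.continuous
  have hrc := hr.continuous
  have hf' : Continuous (deriv f) := hf.continuous_deriv (by norm_num)
  have hfd : ∀ z, HasDerivAt f (deriv f z) z :=
    fun z => (hf.differentiable (by norm_num) z).hasDerivAt
  have hpq := hpq₁.sub hpq₂
  have hy₁ := hpq₁.contU
  have hp₁ := hpq₁.contP
  have hq₁ := hpq₁.contQ
  have hy₂ := hpq₂.contU
  have hp₂ := hpq₂.contP
  have hq₂ := hpq₂.contQ
  have hfy₁ : ContinuousOn (fun x => f (y₁ x a)) (Icc 0 1) := hf.continuous.comp_continuousOn hy₁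
  have hf'y₁ : ContinuousOn (fun x => deriv f (y₁ x a)) (Icc 0 1) := hf'.comp_continuousOn hy₁
  have hry₁ : ContinuousOn (fun x => r (y₁ x a)) (Icc 0 1) := hr.continuous.comp_continuousOn hy₁
  have hfy₂ : ContinuousOn (fun x => f (y₂ x a)) (Icc 0 1) := hf.continuous.comp_continuousOn hy₂
  have hf'y₂ : ContinuousOn (fun x => deriv f (y₂ x a)) (Icc 0 1) := hf'.comp_continuousOn hy₂
  have hry₂ : ContinuousOn (fun x => r (y₂ x a)) (Icc 0 1) := hr.continuous.comp_continuousOn hy₂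
  have hi : ∀ F : ℝ → ℝ, ContinuousOn F (Icc 0 1) → IntervalIntegrable F volume 0 1 :=
    fun F hF => hF.intervalIntegrable_of_Icc zero_le_one
  refine ⟨_, hasDerivWithinAt_integral_sq (C := C₁ + C₂) ha.2
    (fun s hs => (h₁.2.1 s ⟨ha.1.trans_le hs.1, hs.2⟩).continuousOn.sub
      (h₂.2.1 s ⟨ha.1.trans_le hs.1, hs.2⟩).continuousOn) ?_
    (fun x hx => (((heq₁ x hx).hasDerivAt (Iic_mem_nhds ha.2)).sub
      ((heq₂ x hx).hasDerivAt (Iic_mem_nhds ha.2))).hasDerivWithinAt), ?_⟩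
  · intro x hx t ht
    have e : y₁ x t - y₂ x t - (y₁ x a - y₂ x a) =
        (y₁ x t - y₁ x a) - (y₂ x t - y₂ x a) := by ring
    rw [e, add_mul]
    exact (abs_sub _ _).trans (add_le_add (hC₁ x hx t ht) (hC₂ x hx t ht))
  have hparts := hpq.integral_by_parts (G := fun x => f (y₁ x a) - f (y₂ x a))
    (g := fun x => deriv f (y₁ x a) * p₁ x - deriv f (y₂ x a) * p₂ x) (hfy₁.sub hfy₂)
    ((hf'y₁.mul hp₁).sub (hf'y₂.mul hp₂))
    (fun x hx => ((hfd (y₁ x a)).comp x (hpq₁.derivU x hx)).sub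
      ((hfd (y₂ x a)).comp x (hpq₂.derivU x hx)))
  have hsplit : ∫ x in (0:ℝ)..1, 2 * (y₁ x a - y₂ x a) *
        ((q₁ x - deriv f (y₁ x a) * p₁ x + r (y₁ x a)) -
          (q₂ x - deriv f (y₂ x a) * p₂ x + r (y₂ x a))) =
      (∫ x in (0:ℝ)..1, 2 * (y₁ x a - y₂ x a) *
        ((q₁ x - q₂ x) - (deriv f (y₁ x a) * p₁ x - deriv f (y₂ x a) * p₂ x))) +
        ∫ x in (0:ℝ)..1, 2 * (y₁ x a - y₂ x a) * (r (y₁ x a) - r (y₂ x a)) := by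
    rw [← intervalIntegral.integral_add (hi _ (by fun_prop)) (hi _ (by fun_prop))]
    congr 1 with x; ring
  rw [hsplit, hparts, ← intervalIntegral.integral_add (hi _ (by fun_prop)) (hi _ (by fun_prop)),
    sliceEnergy, ← intervalIntegral.integral_const_mul]
  refine intervalIntegral.integral_mono_on zero_le_one (hi _ (by fun_prop)) (hi _ (by fun_prop))
    fun x hx => ?_
  have hF := abs_sub_le_of_lipschitzWith_deriv (hf.differentiable (by norm_num)) hf'K
    (hm₁ x hx) (hm₂ x hx)
  have hR : |r (y₁ x a) - r (y₂ x a)| ≤ K * |y₁ x a - y₂ x a| := by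
    simpa [Real.dist_eq] using hr.dist_le_mul (y₁ x a) (y₂ x a)
  have hF2 : (f (y₁ x a) - f (y₂ x a)) ^ 2 ≤
      (|deriv f 0| + K' * m) ^ 2 * (y₁ x a - y₂ x a) ^ 2 := by
    rw [← sq_abs, ← sq_abs (y₁ x a - y₂ x a), ← mul_pow]
    gcongr
  have hR2 : (y₁ x a - y₂ x a) * (r (y₁ x a) - r (y₂ x a)) ≤ K * (y₁ x a - y₂ x a) ^ 2 := by
    calc _ ≤ |y₁ x a - y₂ x a| * |r (y₁ x a) - r (y₂ x a)| := by
          rw [← abs_mul]; exact le_abs_self _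
      _ ≤ |y₁ x a - y₂ x a| * (K * |y₁ x a - y₂ x a|) := by gcongr
      _ = _ := by rw [← sq_abs (y₁ x a - y₂ x a)]; ring
  have hk : (|deriv f 0| + K' * m) ^ 2 ≤ 2 * (deriv f 0 ^ 2 + K' ^ 2 * m ^ 2) := by
    rw [← sq_abs (deriv f 0)]
    nlinarith [sq_nonneg (|deriv f 0| - K' * m)]
  have hk2 := mul_le_mul_of_nonneg_right hk (sq_nonneg (y₁ x a - y₂ x a))
  nlinarith [sq_nonneg ((f (y₁ x a) - f (y₂ x a)) - 2 * (p₁ x - p₂ x))]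

/-- A priori bound for the `L²` norm of a classical solution. -/
lemma IsClassicalSolutionOnIoc.sliceEnergy_le {f r : ℝ → ℝ} {T : ℝ} {y : ℝ → ℝ → ℝ}
    (hf : ContDiff ℝ 2 f) {K : NNReal} (hr : LipschitzWith K r)
    (h : IsClassicalSolutionOnIoc f r T y) {t : ℝ} (ht : t ∈ Icc 0 T) :
    sliceEnergy y t ≤ Real.exp ((2 * K + 1) * T) * (sliceEnergy y 0 + r 0 ^ 2) := by
  have hgron := le_exp_mul_of_deriv_right_le (g := fun t => sliceEnergy y t + r 0 ^ 2)
    (T := T) (c := 2 * K + 1) ((continuousOn_sliceEnergy h.1).add continuousOn_const) (by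
      intro s hs
      obtain ⟨e, D, hd, hD, -, he⟩ := h.exists_energy_deriv_le hf hr hs
      refine ⟨e, ?_, hd.add_const _⟩
      nlinarith [mul_nonneg K.coe_nonneg (sq_nonneg (r 0))]) t ht
  have hmono : Real.exp ((2 * K + 1) * t) ≤ Real.exp ((2 * K + 1) * T) := by
    gcongr; exact ht.2
  have := mul_le_mul_of_nonneg_right hmono (add_nonneg (sliceEnergy_nonneg y 0) (sq_nonneg (r 0)))
  have := sq_nonneg (r 0)
  linarith

/-- Grönwall estimate for the difference of two classical solutions whose energies stay below
`R`. -/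
lemma IsClassicalSolutionOnIoc.sliceEnergy_sub_le {f r : ℝ → ℝ} {T R : ℝ}
    {y₁ y₂ : ℝ → ℝ → ℝ} (hf : ContDiff ℝ 2 f) {K K' : NNReal} (hr : LipschitzWith K r)
    (hf'K : LipschitzWith K' (deriv f)) (h₁ : IsClassicalSolutionOnIoc f r T y₁)
    (h₂ : IsClassicalSolutionOnIoc f r T y₂) (hR₁ : ∀ t ∈ Icc 0 T, sliceEnergy y₁ t ≤ R)
    (hR₂ : ∀ t ∈ Icc 0 T, sliceEnergy y₂ t ≤ R) {t : ℝ} (ht : t ∈ Icc 0 T) :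
    sliceEnergy (fun x t => y₁ x t - y₂ x t) t ≤
      Real.exp ((deriv f 0 ^ 2 + 2 * K + K' ^ 2 * (2 * R + (2 * K + 1) * R + r 0 ^ 2)) * T
        + K' ^ 2 * R) * sliceEnergy (fun x t => y₁ x t - y₂ x t) 0 := by
  have hT : 0 ≤ T := ht.1.trans ht.2
  have hR0 : 0 ≤ R := (sliceEnergy_nonneg _ _).trans (hR₁ t ht)
  set E : ℝ → ℝ := sliceEnergy (fun x t => y₁ x t - y₂ x t) with hE
  set c : ℝ := deriv f 0 ^ 2 + 2 * K + K' ^ 2 * (2 * R + (2 * K + 1) * R + r 0 ^ 2) with hc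
  set S : ℝ → ℝ := fun t => K' ^ 2 / 2 * (sliceEnergy y₁ t + sliceEnergy y₂ t) with hS
  have hE0 : ∀ s, 0 ≤ E s := sliceEnergy_nonneg _
  have hS0 : ∀ s, 0 ≤ S s := fun s =>
    mul_nonneg (by positivity) (add_nonneg (sliceEnergy_nonneg _ _) (sliceEnergy_nonneg _ _))
  have hEc : ContinuousOn E (Icc 0 T) := continuousOn_sliceEnergy (h₁.1.sub h₂.1)
  have hSc : ContinuousOn S (Icc 0 T) := continuousOn_const.mul
    ((continuousOn_sliceEnergy h₁.1).add (continuousOn_sliceEnergy h₂.1))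
  have hgron := le_exp_mul_of_deriv_right_le (g := fun t => Real.exp (S t) * E t) (T := T) (c := c)
    (hSc.rexp.mul hEc) (by
      intro s hs
      have hsI := Ioo_subset_Icc_self hs
      obtain ⟨e₁, D₁, hd₁, hD₁, hm₁, he₁⟩ := h₁.exists_energy_deriv_le hf hr hs
      obtain ⟨e₂, D₂, hd₂, hD₂, hm₂, he₂⟩ := h₂.exists_energy_deriv_le hf hr hs
      have n₁ := sliceEnergy_nonneg y₁ s
      have n₂ := sliceEnergy_nonneg y₂ s
      set m2 := (sliceEnergy y₁ s + D₁) + (sliceEnergy y₂ s + D₂) with hm2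
      obtain ⟨e, hd, he⟩ := h₁.exists_energy_sub_deriv_le (m := Real.sqrt m2) hf hr hf'K h₂ hs
        (fun x hx => Real.abs_le_sqrt ((hm₁ x hx).trans (by linarith)))
        (fun x hx => Real.abs_le_sqrt ((hm₂ x hx).trans (by linarith)))
      rw [Real.sq_sqrt (by positivity)] at he
      have hSd : HasDerivWithinAt S (K' ^ 2 / 2 * (e₁ + e₂)) (Ici s) s :=
        (hd₁.add hd₂).const_mul _
      refine ⟨_, ?_, hSd.exp.mul hd⟩
      have b₁ := hR₁ s hsI
      have b₂ := hR₂ s hsI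
      have hsum : K' ^ 2 / 2 * (e₁ + e₂) + (deriv f 0 ^ 2 + K' ^ 2 * m2 + 2 * K) ≤ c := by
        have hKE : (2 * K + 1) * (sliceEnergy y₁ s + sliceEnergy y₂ s) ≤
            (2 * K + 1) * (2 * R) := by gcongr; linarith
        have hk : (K' : ℝ) ^ 2 * ((e₁ + e₂) / 2 + m2) ≤
            K' ^ 2 * (2 * R + (2 * K + 1) * R + r 0 ^ 2) :=
          mul_le_mul_of_nonneg_left (by linarith) (by positivity)
        rw [hc]; linarith
      have h1 : K' ^ 2 / 2 * (e₁ + e₂) * E s + e ≤ c * E s := by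
        have := mul_le_mul_of_nonneg_right hsum (hE0 s)
        linarith
      have h2 := mul_le_mul_of_nonneg_left h1 (Real.exp_pos (S s)).le
      linarith) t ht
  have hc0 : 0 ≤ c := by positivity
  have hS0R : S 0 ≤ K' ^ 2 * R := by
    have hz : (0:ℝ) ∈ Icc 0 T := ⟨le_rfl, hT⟩
    have : S 0 ≤ K' ^ 2 / 2 * (R + R) :=
      mul_le_mul_of_nonneg_left (add_le_add (hR₁ 0 hz) (hR₂ 0 hz)) (by positivity)
    linarith
  calc E t ≤ Real.exp (S t) * E t :=
        le_mul_of_one_le_left (hE0 t) (Real.one_le_exp (hS0 t))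
    _ ≤ Real.exp (c * t) * (Real.exp (S 0) * E 0) := hgron
    _ = Real.exp (c * t + S 0) * E 0 := by rw [Real.exp_add, mul_assoc]
    _ ≤ _ := by
        have := hE0 0
        gcongr
        exact ht.2

/-- Lipschitz dependence of the solution on the initial data in `L²`. -/
theorem lipschitz_dependence_on_data
    (f r : ℝ → ℝ) (hf : ContDiff ℝ 2 f) (hr : ContDiff ℝ 2 r)
    (hrLip : ∃ K : NNReal, LipschitzWith K r)
    (hf'Lip : ∃ K : NNReal, LipschitzWith K (deriv f))
    (ρ T : ℝ) (hρ : 0 < ρ) (hT : 0 < T) :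
    ∃ L > (0:ℝ), ∀ y₁ y₂ : ℝ → ℝ → ℝ,
      IsClassicalSolutionOnIoc f r T y₁ → IsClassicalSolutionOnIoc f r T y₂ →
      (∃ u', MemH10 (fun x => y₁ x 0) u') → (∃ u', MemH10 (fun x => y₂ x 0) u') →
      Real.sqrt (∫ x in (0:ℝ)..1, (y₁ x 0) ^ 2) < ρ →
      Real.sqrt (∫ x in (0:ℝ)..1, (y₂ x 0) ^ 2) < ρ →
      ∀ t ∈ Icc (0:ℝ) T,
        (∫ x in (0:ℝ)..1, (y₁ x t - y₂ x t) ^ 2) ≤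
          L * ∫ x in (0:ℝ)..1, (y₁ x 0 - y₂ x 0) ^ 2 := by
  obtain ⟨K, hK⟩ := hrLip
  obtain ⟨K', hK'⟩ := hf'Lip
  refine ⟨_, Real.exp_pos _, fun y₁ y₂ h₁ h₂ _ _ hρ₁ hρ₂ t ht =>
    h₁.sliceEnergy_sub_le (R := Real.exp ((2 * K + 1) * T) * (ρ ^ 2 + r 0 ^ 2)) hf hK hK' h₂
      ?_ ?_ ht⟩
  · intro s hs
    refine (h₁.sliceEnergy_le hf hK hs).trans ?_
    gcongr
    exact ((Real.sqrt_lt' hρ).1 hρ₁).le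
  · intro s hs
    refine (h₂.sliceEnergy_le hf hK hs).trans ?_
    gcongr
    exact ((Real.sqrt_lt' hρ).1 hρ₂).le
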